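/- In Ỹ (with higher modes defined by the recursion in the context), for every i ∈ {0,m} and all r,s ∈ ℤ_{≥0}: (1) [x^±_{i,r}, x^±_{i,s}] = 0 (in particular relation (1.7) of the affine super Yangian holds), and (2) [x⁺_{i,r}, x⁻_{i,s}] = h_{i,r+s}. -/

import Mathlib

noncomputable section

open scoped BigOperators

/-- The parity function `p` on indices, realized on `ZMod (m+n)`:
`p(i) = 0` for `1 ≤ i ≤ m` and `p(i) = 1` otherwise (so `p(0) = 1`). -/
def ppar (m n : ℕ) (i : ZMod (m + n)) : ℕ :=
  if 1 ≤ i.val ∧ i.val ≤ m then 0 else 1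

/-- Parity of the generators `x^±_{i,r}`: they are odd exactly when `i = 0` or `i = m`. -/
def gpar (m n : ℕ) (i : ZMod (m + n)) : ℕ := (ppar m n i + ppar m n (i + 1)) % 2

/-- The integer valued Cartan matrix `a_{i,j}` of `\hat{sl}(m|n)`.
The cyclic cases `(0, m+n-1)` and `(m+n-1, 0)` are covered by the clauses
`j = i - 1` and `j = i + 1` in `ZMod (m+n)`. -/
def aZ (m n : ℕ) (i j : ZMod (m + n)) : ℤ :=
  if i = j then (-1) ^ ppar m n i + (-1) ^ ppar m n (i + 1)
  else if j = i + 1 then -(-1) ^ ppar m n (i + 1)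
  else if j = i - 1 then -(-1) ^ ppar m n i
  else 0

/-- `a_{i,j}` as a complex number. -/
def aC (m n : ℕ) (i j : ZMod (m + n)) : ℂ := (aZ m n i j : ℂ)

/-- The matrix `b_{i,j}`. -/
def bC (m n : ℕ) (i j : ZMod (m + n)) : ℂ :=
  if i = ((m + n - 1 : ℕ) : ZMod (m + n)) ∧ j = 0 then 1
  else if i = j + 1 then -(-1) ^ ppar m n (i + 1)
  else if i = j - 1 then (-1) ^ ppar m n i
  else 0

variable {A : Type*} [Ring A] [Algebra ℂ A]

/-- The supercommutator `[x,y] = xy - (-1)^{p(x)p(y)} yx` of elements of parities `px`, `py`. -/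
def sbr (px py : ℕ) (x y : A) : A := x * y - ((-1 : ℂ) ^ (px * py)) • (y * x)

/-- The anticommutator `{x,y} = xy + yx`. -/
def acm (x y : A) : A := x * y + y * x

/-- The sign `±1` governing the `x^+`/`x^-` cases. -/
def sgn (b : Bool) : ℂ := if b then 1 else -1

/-- Iterated super-adjoint action `(ad x)^k y`, where `x` has parity `px` and `y` parity `py`. -/
def adPow (px : ℕ) (x : A) (py : ℕ) (y : A) : ℕ → A
  | 0 => y
  | k + 1 => sbr px ((py + k * px) % 2) x (adPow px x py y k)

/-- Nested supercommutator `[g 0, [g 1, … , [g (k-1), y] … ]]` where every `g l`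
has parity `px` and `y` has parity `py`. -/
def serreNest (px py : ℕ) : (k : ℕ) → (Fin k → A) → A → A
  | 0, _, y => y
  | k + 1, g, y => sbr px ((py + k * px) % 2) (g 0) (serreNest px py k (fun l => g l.succ) y)

/-- `h̃_{i,1} = h_{i,1} - ((ε₁+ε₂)/2) h_{i,0}²`. -/
def htld (m n : ℕ) (ε₁ ε₂ : ℂ) (H : ZMod (m + n) → ℕ → A) (i : ZMod (m + n)) : A :=
  H i 1 - ((ε₁ + ε₂) / 2) • (H i 0 * H i 0)

/-- A representation of the minimalistic presentation `Ỹ` of the affine super Yangian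
`Y_{ε₁,ε₂}(ŝl(m|n))`: elements `x^±_{i,r}`, `h_{i,r}` of an associative `ℂ`-algebra
satisfying the defining relations (2.1)–(2.9) for the modes `r ∈ {0,1}`, together with
the recursive definition of the higher modes `r ≥ 2`. -/
structure YtildeRep (m n : ℕ) (ε₁ ε₂ : ℂ) (A : Type*) [Ring A] [Algebra ℂ A] where
  /-- `x^+_{i,r}` (`b = true`) and `x^-_{i,r}` (`b = false`). -/
  X : Bool → ZMod (m + n) → ℕ → A
  /-- `h_{i,r}`. -/
  H : ZMod (m + n) → ℕ → A
  rel21 : ∀ (i j : ZMod (m + n)) (r s : ℕ), r ≤ 1 → s ≤ 1 → H i r * H j s = H j s * H i r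
  rel22 : ∀ i j : ZMod (m + n),
      sbr (gpar m n i) (gpar m n j) (X true i 0) (X false j 0) = if i = j then H i 0 else 0
  rel23a : ∀ i j : ZMod (m + n),
      sbr (gpar m n i) (gpar m n j) (X true i 1) (X false j 0) = if i = j then H i 1 else 0
  rel23b : ∀ i j : ZMod (m + n),
      sbr (gpar m n i) (gpar m n j) (X true i 0) (X false j 1) = if i = j then H i 1 else 0
  rel24 : ∀ (b : Bool) (i j : ZMod (m + n)) (r : ℕ), r ≤ 1 →
      H i 0 * X b j r - X b j r * H i 0 = (sgn b * aC m n i j) • X b j r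
  rel25 : ∀ (b : Bool) (i j : ZMod (m + n)),
      htld m n ε₁ ε₂ H i * X b j 0 - X b j 0 * htld m n ε₁ ε₂ H i
        = (sgn b * aC m n i j) • (X b j 1 - (bC m n i j * ((ε₁ - ε₂) / 2)) • X b j 0)
  rel26 : ∀ (b : Bool) (i j : ZMod (m + n)),
      sbr (gpar m n i) (gpar m n j) (X b i 1) (X b j 0)
          - sbr (gpar m n i) (gpar m n j) (X b i 0) (X b j 1)
        = (sgn b * aC m n i j * ((ε₁ + ε₂) / 2)) • acm (X b i 0) (X b j 0)
          - (bC m n i j * ((ε₁ - ε₂) / 2)) •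
              sbr (gpar m n i) (gpar m n j) (X b i 0) (X b j 0)
  rel27 : ∀ (b : Bool) (i j : ZMod (m + n)), i ≠ j →
      adPow (gpar m n i) (X b i 0) (gpar m n j) (X b j 0) (1 + (aZ m n i j).natAbs) = 0
  rel28 : ∀ (b : Bool) (i : ZMod (m + n)), i = 0 ∨ i = (m : ZMod (m + n)) →
      sbr (gpar m n i) (gpar m n i) (X b i 0) (X b i 0) = 0
  rel29 : ∀ (b : Bool) (i : ZMod (m + n)), i = 0 ∨ i = (m : ZMod (m + n)) →
      sbr ((gpar m n (i - 1) + gpar m n i) % 2) ((gpar m n i + gpar m n (i + 1)) % 2)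
        (sbr (gpar m n (i - 1)) (gpar m n i) (X b (i - 1) 0) (X b i 0))
        (sbr (gpar m n i) (gpar m n (i + 1)) (X b i 0) (X b (i + 1) 0)) = 0
  recX : ∀ (b : Bool) (i : ZMod (m + n)) (r : ℕ), 1 ≤ r →
      X b i (r + 1) =
        if i = 0 ∨ i = (m : ZMod (m + n)) then
          (sgn b * (aC m n (i + 1) i)⁻¹) •
              (htld m n ε₁ ε₂ H (i + 1) * X b i r - X b i r * htld m n ε₁ ε₂ H (i + 1))
            + (bC m n (i + 1) i * ((ε₁ - ε₂) / 2)) • X b i r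
        else
          (sgn b * (aC m n i i)⁻¹) •
            (htld m n ε₁ ε₂ H i * X b i r - X b i r * htld m n ε₁ ε₂ H i)
  recH : ∀ (i : ZMod (m + n)) (r : ℕ), 1 ≤ r →
      H i (r + 1) = sbr (gpar m n i) (gpar m n i) (X true i (r + 1)) (X false i 0)


attribute [local instance] LieRing.ofAssociativeRing LieAlgebra.ofAssociativeAlgebra

/-- The commutator with a fixed element is a derivation. -/
theorem lie_mul_eq {R : Type*} [Ring R] (s x y : R) : ⁅s, x * y⁆ = ⁅s, x⁆ * y + x * ⁅s, y⁆ := by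
  simp only [Ring.lie_def]; noncomm_ring

/-- The twisted commutator `xy - σ yx`. -/
def scomm (σ : ℂ) (x y : A) : A := x * y - σ • (y * x)

theorem lie_scomm (σ : ℂ) (s x y : A) :
    ⁅s, scomm σ x y⁆ = scomm σ ⁅s, x⁆ y + scomm σ x ⁅s, y⁆ := by
  simp only [scomm, lie_sub, lie_smul, lie_mul_eq]; module

theorem scomm_smul_left (σ c : ℂ) (x y : A) : scomm σ (c • x) y = c • scomm σ x y := by
  simp only [scomm, smul_mul_assoc, mul_smul_comm]; module

theorem scomm_smul_right (σ c : ℂ) (x y : A) : scomm σ x (c • y) = c • scomm σ x y := by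
  simp only [scomm, smul_mul_assoc, mul_smul_comm]; module

theorem scomm_neg_right (σ : ℂ) (x y : A) : scomm σ x (-y) = -scomm σ x y := by
  simp only [scomm, mul_neg, neg_mul]; module

/-- If the sequence `h` acts on `x` and `y` by the Drinfeld recursion, and the twisted commutators
`[x_s, y_t]` depend only on `s + t` in degrees below `N`, then in degree `N` the commutators
`[h_p, [x_s, y_t]]` are multiples of the defect `Z`. -/
theorem lie_scomm_eq_nsmul_defect {h x y : ℕ → A} {σ κ c : ℂ} {Z : A} {M N : ℕ}
    (hx0 : ∀ r, ⁅h 0, x r⁆ = c • x r) (hy0 : ∀ r, ⁅h 0, y r⁆ = -(c • y r))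
    (hx : ∀ p r, p < M → ⁅h (p + 1), x r⁆ = ⁅h p, x (r + 1)⁆ + κ • (h p * x r + x r * h p))
    (hy : ∀ p r, p < M → ⁅h (p + 1), y r⁆ = ⁅h p, y (r + 1)⁆ - κ • (h p * y r + y r * h p))
    (hlow : ∀ s t, s + t + 1 < N → scomm σ (x (s + 1)) (y t) = scomm σ (x s) (y (t + 1)))
    (htop : ∀ s t, s + t + 1 = N → scomm σ (x (s + 1)) (y t) = scomm σ (x s) (y (t + 1)) + Z)
    (p : ℕ) (hp : p ≤ M) :
    (∀ s t, p + s + t < N → ⁅h p, scomm σ (x s) (y t)⁆ = 0) ∧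
    (∀ s t, p + s + t = N → ⁅h p, scomm σ (x s) (y t)⁆ = ((p : ℂ) * c) • Z) := by
  suffices H : (∀ s t, p + s + t + 1 < N →
        scomm σ (x s) ⁅h p, y (t + 1)⁆ - scomm σ (x (s + 1)) ⁅h p, y t⁆
          + κ • ⁅h p, scomm (-σ) (x s) (y t)⁆ = 0) ∧
      (∀ s t, p + s + t + 1 = N →
        scomm σ (x s) ⁅h p, y (t + 1)⁆ - scomm σ (x (s + 1)) ⁅h p, y t⁆
          + κ • ⁅h p, scomm (-σ) (x s) (y t)⁆ = c • Z) ∧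
      (∀ s t, p + s + t < N → ⁅h p, scomm σ (x s) (y t)⁆ = 0) ∧
      (∀ s t, p + s + t = N → ⁅h p, scomm σ (x s) (y t)⁆ = ((p : ℂ) * c) • Z) from H.2.2
  induction p with
  | zero =>
    have key : ∀ τ s t, ⁅h 0, scomm τ (x s) (y t)⁆ = 0 := by
      intro τ s t
      rw [lie_scomm, hx0, hy0, scomm_smul_left, scomm_neg_right, scomm_smul_right, add_neg_cancel]
    refine ⟨fun s t hst => ?_, fun s t hst => ?_, fun s t _ => key _ _ _, fun s t _ => ?_⟩
    · rw [key, hy0, hy0, scomm_neg_right, scomm_neg_right, scomm_smul_right, scomm_smul_right,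
        hlow s t (by omega)]
      module
    · rw [key, hy0, hy0, scomm_neg_right, scomm_neg_right, scomm_smul_right, scomm_smul_right,
        htop s t (by omega)]
      module
    · rw [key]; simp
  | succ p ih =>
    obtain ⟨i1, i2, i3, i4⟩ := ih (by omega)
    have step : ∀ s t,
        scomm σ (x s) ⁅h (p + 1), y (t + 1)⁆ - scomm σ (x (s + 1)) ⁅h (p + 1), y t⁆
          + κ • ⁅h (p + 1), scomm (-σ) (x s) (y t)⁆ =
        (scomm σ (x s) ⁅h p, y (t + 1 + 1)⁆ - scomm σ (x (s + 1)) ⁅h p, y (t + 1)⁆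
          + κ • ⁅h p, scomm (-σ) (x s) (y (t + 1))⁆) +
        κ • (h p * (scomm σ (x (s + 1)) (y t) - scomm σ (x s) (y (t + 1))) +
          (scomm σ (x (s + 1)) (y t) - scomm σ (x s) (y (t + 1))) * h p) +
        (κ * κ) • ⁅h p, scomm σ (x s) (y t)⁆ := by
      intro s t
      rw [lie_scomm (-σ), hx p s (by omega), hy p t (by omega), hy p (t + 1) (by omega)]
      simp only [scomm, Ring.lie_def, mul_add, add_mul, mul_sub, sub_mul, smul_mul_assoc,
        mul_smul_comm, mul_assoc, smul_add, smul_sub, smul_smul]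
      module
    have stepc : ∀ s t, ⁅h (p + 1), scomm σ (x s) (y t)⁆ = ⁅h p, scomm σ (x (s + 1)) (y t)⁆ +
        (scomm σ (x s) ⁅h p, y (t + 1)⁆ - scomm σ (x (s + 1)) ⁅h p, y t⁆
          + κ • ⁅h p, scomm (-σ) (x s) (y t)⁆) := by
      intro s t
      rw [lie_scomm σ (h (p + 1)), hx p s (by omega), hy p t (by omega)]
      simp only [scomm, Ring.lie_def, mul_add, add_mul, mul_sub, sub_mul, smul_mul_assoc,
        mul_smul_comm, mul_assoc, smul_add, smul_sub, smul_smul]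
      module
    refine ⟨fun s t hst => ?_, fun s t hst => ?_, fun s t hst => ?_, fun s t hst => ?_⟩
    · rw [step, i1 s (t + 1) (by omega), hlow s t (by omega), i3 s t (by omega)]; simp
    · rw [step, i2 s (t + 1) (by omega), hlow s t (by omega), i3 s t (by omega)]; simp
    · rw [stepc, i3 (s + 1) t (by omega), i1 s t (by omega), add_zero]
    · rw [stepc, i4 (s + 1) t (by omega), i2 s t (by omega)]; push_cast; module

/-- The anticommutators `{x_r, x_s}` vanish as soon as `{x_0, x_0} = 0`, given a derivation
shifting the modes of `x` and elements `h_0, h_1, h_2` acting by the Drinfeld recursion. -/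
theorem anticomm_eq_zero {h x : ℕ → A} {κ c : ℂ} {S : A} (hc : c ≠ 0)
    (hS : ∀ r, ⁅S, x r⁆ = x (r + 1)) (hx0 : ∀ r, ⁅h 0, x r⁆ = c • x r)
    (hx : ∀ p r, ⁅h (p + 1), x r⁆ = ⁅h p, x (r + 1)⁆ + κ • (h p * x r + x r * h p))
    (h00 : x 0 * x 0 + x 0 * x 0 = 0) (r s : ℕ) : x r * x s + x s * x r = 0 := by
  have two : ∀ z : A, z + z = 0 → z = 0 := by
    intro z hz
    have : (2 : ℂ) • z = 0 := by rw [two_smul, hz]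
    exact (smul_eq_zero.mp this).resolve_left two_ne_zero
  have shift : ∀ r s, x r * x s + x s * x r = 0 →
      x (r + 1) * x s + x s * x (r + 1) = -(x r * x (s + 1) + x (s + 1) * x r) := by
    intro r s hrs
    have := congrArg (fun z => ⁅S, z⁆) hrs
    simp only [lie_add, lie_mul_eq, hS, lie_zero] at this
    rw [eq_neg_iff_add_eq_zero, ← this]
    abel
  have shift_two : ∀ r s, x r * x s + x s * x r = 0 →
      x (r + 1) * x s + x s * x (r + 1) = 0 → x r * x (s + 1) + x (s + 1) * x r = 0 →
      (x (r + 2) * x s + x s * x (r + 2)) + (x r * x (s + 2) + x (s + 2) * x r) = 0 := by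
    intro r s q0 q1 q2
    have e0 : ∀ r, x r * h 0 = h 0 * x r - c • x r := fun r => by
      rw [← hx0, Ring.lie_def]; abel
    have e1 : ∀ r, x r * h 1 = h 1 * x r - c • x (r + 1) - κ • (2 • (h 0 * x r) - c • x r) :=
      fun r => by
        have := hx 0 r
        rw [hx0, e0, zero_add, Ring.lie_def] at this
        linear_combination (norm := module) (-1 : ℂ) • this
    have e2 : ∀ r, x r * h 2 = h 2 * x r - (c • x (r + 2) + (2 * κ) • (h 0 * x (r + 1))
        - (2 * c * κ) • x (r + 1) + (2 * κ) • (h 1 * x r) - (2 * κ * κ) • (h 0 * x r)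
        + (c * κ * κ) • x r) := fun r => by
      have := hx 1 r
      rw [Ring.lie_def, Ring.lie_def, one_add_one_eq_two, e1, e1] at this
      linear_combination (norm := module) (-1 : ℂ) • this
    have e0' : ∀ r z, x r * (h 0 * z) = (h 0 * x r - c • x r) * z := fun r z => by
      rw [← mul_assoc, e0]
    have e1' : ∀ r z, x r * (h 1 * z) =
        (h 1 * x r - c • x (r + 1) - κ • (2 • (h 0 * x r) - c • x r)) * z := fun r z => by
      rw [← mul_assoc, e1]
    have e2' : ∀ r z, x r * (h 2 * z) = (h 2 * x r - (c • x (r + 2) +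
        (2 * κ) • (h 0 * x (r + 1)) - (2 * c * κ) • x (r + 1) + (2 * κ) • (h 1 * x r)
        - (2 * κ * κ) • (h 0 * x r) + (c * κ * κ) • x r)) * z := fun r z => by
      rw [← mul_assoc, e2]
    have q0' : ∀ z, z * (x r * x s) = - (z * (x s * x r)) := fun z => by
      rw [eq_neg_iff_add_eq_zero, ← mul_add, q0, mul_zero]
    have q1' : ∀ z, z * (x (r + 1) * x s) = - (z * (x s * x (r + 1))) := fun z => by
      rw [eq_neg_iff_add_eq_zero, ← mul_add, q1, mul_zero]
    have q2' : ∀ z, z * (x r * x (s + 1)) = - (z * (x (s + 1) * x r)) := fun z => by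
      rw [eq_neg_iff_add_eq_zero, ← mul_add, q2, mul_zero]
    have main : (x r * x s + x s * x r) * h 2 = 0 := by rw [q0, zero_mul]
    simp only [add_mul, mul_assoc, e2, e2', e1', e0', mul_add, mul_sub, sub_mul, smul_mul_assoc,
      mul_smul_comm, smul_sub, smul_smul, q0', q1', q2'] at main
    have : c • ((x (r + 2) * x s + x s * x (r + 2)) + (x r * x (s + 2) + x (s + 2) * x r)) = 0 := by
      linear_combination (norm := module) (-1 : ℂ) • main + (4 * c * κ) • q1
        + (4 * c * κ) • q2 - (6 * c * κ * κ) • q0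
    exact (smul_eq_zero.mp this).resolve_left hc
  suffices H : ∀ N r s, r + s = N → x r * x s + x s * x r = 0 from H _ r s rfl
  intro N
  induction N using Nat.strong_induction_on with
  | _ N ih =>
    have zero_left : x 0 * x N + x N * x 0 = 0 := by
      match N, ih with
      | 0, _ => exact h00
      | 1, ih =>
        have := shift 0 0 h00
        apply two
        linear_combination (norm := module) this
      | k + 2, ih =>
        have a1 := shift 0 (k + 1) (ih (k + 1) (by omega) _ _ (by omega))
        have a2 := shift 1 k (ih (k + 1) (by omega) _ _ (by omega))
        have a3 := shift_two 0 k (ih k (by omega) _ _ (by omega))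
          (ih (k + 1) (by omega) _ _ (by omega)) (ih (k + 1) (by omega) _ _ (by omega))
        apply two
        linear_combination (norm := module) a1 - a2 + a3
    intro r
    induction r with
    | zero => intro s hs; obtain rfl : s = N := by omega
              exact zero_left
    | succ r ihr =>
      intro s hs
      rw [shift r s (ih (r + s) (by omega) _ _ rfl), ihr (s + 1) (by omega), neg_zero]

/-- Two adjacent nodes with raising modes `x`, `u` and lowering modes `y`, `v`, together with
elements `S`, `T` whose commutators shift the modes of one node and annihilate those of the
other. -/
structure IsNodePair (x y u v : ℕ → A) (S T : A) (σ τ κ c : ℂ) : Prop where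
  S_x : ∀ r, ⁅S, x r⁆ = x (r + 1)
  S_y : ∀ r, ⁅S, y r⁆ = -y (r + 1)
  S_u : ∀ r, ⁅S, u r⁆ = 0
  S_v : ∀ r, ⁅S, v r⁆ = 0
  T_x : ∀ r, ⁅T, x r⁆ = 0
  T_y : ∀ r, ⁅T, y r⁆ = 0
  T_u : ∀ r, ⁅T, u r⁆ = u (r + 1)
  T_v : ∀ r, ⁅T, v r⁆ = -v (r + 1)
  plus : ⁅x 1, u 0⁆ - ⁅x 0, u 1⁆ = κ • (x 0 * u 0 + u 0 * x 0)
  minus : ⁅y 1, v 0⁆ - ⁅y 0, v 1⁆ = -(κ • (y 0 * v 0 + v 0 * y 0))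
  lie_x_v : ⁅x 0, v 0⁆ = 0
  lie_u_y : ⁅u 0, y 0⁆ = 0
  weight_x : ⁅scomm τ (u 0) (v 0), x 0⁆ = c • x 0
  weight_y : ⁅scomm τ (u 0) (v 0), y 0⁆ = -(c • y 0)
  weight_u : ⁅scomm σ (x 0) (y 0), u 0⁆ = c • u 0
  weight_v : ⁅scomm σ (x 0) (y 0), v 0⁆ = -(c • v 0)
  scomm_x_y : scomm σ (x 1) (y 0) = scomm σ (x 0) (y 1)
  scomm_u_v : scomm τ (u 1) (v 0) = scomm τ (u 0) (v 1)
  cartan_comm : ⁅scomm τ (u 1) (v 0), scomm σ (x 1) (y 0)⁆ = 0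
  c_ne_zero : c ≠ 0

namespace IsNodePair

variable {x y u v : ℕ → A} {S T : A} {σ τ κ c : ℂ}

theorem symm (P : IsNodePair x y u v S T σ τ κ c) : IsNodePair u v x y T S τ σ κ c where
  S_x := P.T_u
  S_y := P.T_v
  S_u := P.T_x
  S_v := P.T_y
  T_x := P.S_u
  T_y := P.S_v
  T_u := P.S_x
  T_v := P.S_y
  plus := by
    rw [add_comm, ← P.plus, ← lie_skew (x 0) (u 1), ← lie_skew (x 1) (u 0)]; abel
  minus := by
    rw [add_comm, ← P.minus, ← lie_skew (y 0) (v 1), ← lie_skew (y 1) (v 0)]; abel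
  lie_x_v := P.lie_u_y
  lie_u_y := P.lie_x_v
  weight_x := P.weight_u
  weight_y := P.weight_v
  weight_u := P.weight_x
  weight_v := P.weight_y
  scomm_x_y := P.scomm_u_v
  scomm_u_v := P.scomm_x_y
  cartan_comm := by rw [← lie_skew, P.cartan_comm, neg_zero]
  c_ne_zero := P.c_ne_zero

theorem plus_modes (P : IsNodePair x y u v S T σ τ κ c) (r s : ℕ) :
    ⁅x (r + 1), u s⁆ - ⁅x r, u (s + 1)⁆ = κ • (x r * u s + u s * x r) := by
  induction s with
  | zero =>
    induction r with
    | zero => exact P.plus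
    | succ r ih =>
      have := congrArg (fun z => ⁅S, z⁆) ih
      simpa [lie_mul_eq, P.S_x, P.S_u, leibniz_lie S] using this
  | succ s ih =>
    have := congrArg (fun z => ⁅T, z⁆) ih
    simpa [lie_mul_eq, P.T_x, P.T_u, leibniz_lie T] using this

theorem minus_modes (P : IsNodePair x y u v S T σ τ κ c) (r s : ℕ) :
    ⁅y (r + 1), v s⁆ - ⁅y r, v (s + 1)⁆ = -(κ • (y r * v s + v s * y r)) := by
  induction s with
  | zero =>
    induction r with
    | zero => exact P.minus
    | succ r ih =>
      have := congrArg (fun z => -⁅S, z⁆) ih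
      simp only [lie_mul_eq, P.S_y, P.S_v, leibniz_lie S, lie_sub, lie_neg, lie_smul, lie_add,
        neg_lie, lie_zero, neg_mul, mul_neg, mul_zero, zero_mul] at this
      linear_combination (norm := module) this
  | succ s ih =>
    have := congrArg (fun z => -⁅T, z⁆) ih
    simp only [lie_mul_eq, P.T_y, P.T_v, leibniz_lie T, lie_sub, lie_neg, lie_smul, lie_add,
      zero_lie, neg_mul, mul_neg, mul_zero, zero_mul] at this
    linear_combination (norm := module) this

theorem lie_x_v_modes (P : IsNodePair x y u v S T σ τ κ c) (r s : ℕ) : ⁅x r, v s⁆ = 0 := by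
  induction s with
  | zero =>
    induction r with
    | zero => exact P.lie_x_v
    | succ r ih =>
      have := congrArg (fun z => ⁅S, z⁆) ih
      simpa [leibniz_lie S, P.S_x, P.S_v] using this
  | succ s ih =>
    have := congrArg (fun z => ⁅T, z⁆) ih
    simpa only [leibniz_lie T, P.T_x, P.T_v, zero_lie, zero_add, lie_neg, lie_zero,
      neg_eq_zero] using this

theorem lie_S_scomm_u_v (P : IsNodePair x y u v S T σ τ κ c) (r s : ℕ) :
    ⁅S, scomm τ (u r) (v s)⁆ = 0 := by
  rw [lie_scomm, P.S_u, P.S_v]; simp [scomm]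

theorem lie_S_scomm_x_y (P : IsNodePair x y u v S T σ τ κ c) (r s : ℕ) :
    ⁅S, scomm σ (x r) (y s)⁆ = scomm σ (x (r + 1)) (y s) - scomm σ (x r) (y (s + 1)) := by
  rw [lie_scomm, P.S_x, P.S_y, scomm_neg_right, sub_eq_add_neg]

theorem weight_x_modes (P : IsNodePair x y u v S T σ τ κ c) (r : ℕ) :
    ⁅scomm τ (u 0) (v 0), x r⁆ = c • x r := by
  induction r with
  | zero => exact P.weight_x
  | succ r ih =>
    have := congrArg (fun z => ⁅S, z⁆) ih
    simpa only [leibniz_lie S, P.S_x, P.lie_S_scomm_u_v, zero_lie, zero_add, lie_smul] using this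

theorem weight_y_modes (P : IsNodePair x y u v S T σ τ κ c) (r : ℕ) :
    ⁅scomm τ (u 0) (v 0), y r⁆ = -(c • y r) := by
  induction r with
  | zero => exact P.weight_y
  | succ r ih =>
    have := congrArg (fun z => -⁅S, z⁆) ih
    simpa only [leibniz_lie S, P.S_y, P.lie_S_scomm_u_v, zero_lie, zero_add, lie_smul, lie_neg,
      neg_neg, smul_neg] using this

/-- The Drinfeld recursion for the action of the Cartan modes of the second node on `x`. -/
theorem lie_scomm_x (P : IsNodePair x y u v S T σ τ κ c) (p t r : ℕ) :
    ⁅scomm τ (u (p + 1)) (v t), x r⁆ = ⁅scomm τ (u p) (v t), x (r + 1)⁆ +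
      κ • (scomm τ (u p) (v t) * x r + x r * scomm τ (u p) (v t)) := by
  have comm : ∀ r s, x r * v s = v s * x r := fun r s => by
    have := P.lie_x_v_modes r s
    rwa [Ring.lie_def, sub_eq_zero] at this
  have comm' : ∀ r s z, x r * (v s * z) = v s * (x r * z) := fun r s z => by
    rw [← mul_assoc, comm, mul_assoc]
  have key := P.symm.plus_modes p r
  have h1 := congrArg (fun z => z * v t - τ • (v t * z)) key
  simp only [Ring.lie_def, scomm, mul_add, add_mul, mul_sub, sub_mul, smul_mul_assoc,
    mul_smul_comm, mul_assoc, smul_add, smul_sub, comm, comm'] at h1 ⊢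
  linear_combination (norm := module) h1

/-- The Drinfeld recursion for the action of the Cartan modes of the second node on `y`. -/
theorem lie_scomm_y (P : IsNodePair x y u v S T σ τ κ c) (p t r : ℕ) :
    ⁅scomm τ (u t) (v (p + 1)), y r⁆ = ⁅scomm τ (u t) (v p), y (r + 1)⁆ -
      κ • (scomm τ (u t) (v p) * y r + y r * scomm τ (u t) (v p)) := by
  have comm : ∀ r s, y r * u s = u s * y r := fun r s => by
    have := P.symm.lie_x_v_modes s r
    rw [Ring.lie_def, sub_eq_zero] at this
    exact this.symm
  have comm' : ∀ r s z, y r * (u s * z) = u s * (y r * z) := fun r s z => by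
    rw [← mul_assoc, comm, mul_assoc]
  have key := P.symm.minus_modes p r
  have h1 := congrArg (fun z => u t * z - τ • (z * u t)) key
  simp only [Ring.lie_def, scomm, mul_add, add_mul, mul_sub, sub_mul, smul_mul_assoc,
    mul_smul_comm, mul_assoc, smul_add, smul_sub, neg_mul, mul_neg, comm, comm'] at h1 ⊢
  linear_combination (norm := module) h1

/-- The Cartan modes of the second node against those of the first one, in the first degree
`K + 1` in which the latter are not yet known to be well defined. -/
theorem lie_cartan_eq_nsmul_defect (P : IsNodePair x y u v S T σ τ κ c) {K : ℕ}
    (hg : ∀ r s, r + s ≤ K → scomm σ (x r) (y s) = scomm σ (x (r + s)) (y 0))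
    (hG : ∀ r s, r + s ≤ K → scomm τ (u r) (v s) = scomm τ (u (r + s)) (v 0))
    {p q : ℕ} (hp : p ≤ K) (hpq : p + q = K + 1) :
    ⁅scomm τ (u p) (v 0), scomm σ (x q) (y 0)⁆ =
      ((p : ℂ) * c) • ⁅S, scomm σ (x K) (y 0)⁆ := by
  refine (lie_scomm_eq_nsmul_defect (h := fun p => scomm τ (u p) (v 0)) (κ := κ) (M := K)
    P.weight_x_modes P.weight_y_modes (fun p r _ => P.lie_scomm_x p 0 r) (fun p r hpK => ?_)
    (fun s t hst => ?_) (fun s t hst => ?_) p hp).2 q 0 hpq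
  · have h := P.lie_scomm_y p 0 r
    rwa [hG 0 (p + 1) (by omega), hG 0 p (by omega), zero_add, zero_add] at h
  · rw [hg (s + 1) t (by omega), hg s (t + 1) (by omega)]
    congr 2; omega
  · obtain rfl : K = s + t := by omega
    rw [← hg s t le_rfl, P.lie_S_scomm_x_y]; abel

theorem defect_eq_zero (P : IsNodePair x y u v S T σ τ κ c) {K : ℕ} (hK : 1 ≤ K)
    (hg : ∀ r s, r + s ≤ K → scomm σ (x r) (y s) = scomm σ (x (r + s)) (y 0))
    (hG : ∀ r s, r + s ≤ K → scomm τ (u r) (v s) = scomm τ (u (r + s)) (v 0)) :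
    ⁅S, scomm σ (x K) (y 0)⁆ = 0 := by
  have h1 := P.lie_cartan_eq_nsmul_defect hg hG hK (add_comm 1 K)
  rcases hK.eq_or_lt with rfl | hK'
  · rw [P.cartan_comm, Nat.cast_one, one_mul] at h1
    exact (smul_eq_zero.mp h1.symm).resolve_left P.c_ne_zero
  · have h2 := P.lie_cartan_eq_nsmul_defect hg hG le_rfl rfl
    have h3 := P.symm.lie_cartan_eq_nsmul_defect hG hg hK (add_comm 1 K)
    have h4 := P.symm.lie_cartan_eq_nsmul_defect hG hg le_rfl rfl
    rw [← lie_skew, h2] at h3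
    rw [← lie_skew, h1] at h4
    have h5 : (((K : ℂ) * K - 1) * c) • ⁅S, scomm σ (x K) (y 0)⁆ = 0 := by
      push_cast at h3 h4
      linear_combination (norm := module) h4 - (K : ℂ) • h3
    refine (smul_eq_zero.mp h5).resolve_left (mul_ne_zero (sub_ne_zero.mpr ?_) P.c_ne_zero)
    have : K * K ≠ 1 := by nlinarith
    exact_mod_cast this

theorem scomm_modes_succ (P : IsNodePair x y u v S T σ τ κ c) {K : ℕ} (hK : 1 ≤ K)
    (hg : ∀ r s, r + s ≤ K → scomm σ (x r) (y s) = scomm σ (x (r + s)) (y 0))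
    (hG : ∀ r s, r + s ≤ K → scomm τ (u r) (v s) = scomm τ (u (r + s)) (v 0))
    (r s : ℕ) (hrs : r + s ≤ K + 1) : scomm σ (x r) (y s) = scomm σ (x (r + s)) (y 0) := by
  induction s generalizing r with
  | zero => rfl
  | succ s ih =>
    rcases Nat.lt_or_ge K (r + (s + 1)) with hlt | hle
    · obtain rfl : K = r + s := by omega
      have h := P.defect_eq_zero hK hg hG
      rw [← hg r s le_rfl, P.lie_S_scomm_x_y, sub_eq_zero] at h
      rw [← h, ih (r + 1) (by omega)]
      congr 2; omega
    · exact hg _ _ hle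

/-- The twisted commutators `[x_r, y_s]` of a node depend only on `r + s`. -/
theorem scomm_modes (P : IsNodePair x y u v S T σ τ κ c) :
    ∀ K, (∀ r s, r + s ≤ K → scomm σ (x r) (y s) = scomm σ (x (r + s)) (y 0)) ∧
      (∀ r s, r + s ≤ K → scomm τ (u r) (v s) = scomm τ (u (r + s)) (v 0)) := by
  have base : ∀ {x y u v : ℕ → A} {S T : A} {σ τ : ℂ}, IsNodePair x y u v S T σ τ κ c →
      ∀ r s, r + s ≤ 1 → scomm σ (x r) (y s) = scomm σ (x (r + s)) (y 0) := by
    intro x y u v S T σ τ P r s hrs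
    match r, s with
    | _, 0 => rfl
    | 0, 1 => exact P.scomm_x_y.symm
    | 0, s + 2 => omega
    | r + 1, s + 1 => omega
  have step : ∀ K, (∀ r s, r + s ≤ K + 1 → scomm σ (x r) (y s) = scomm σ (x (r + s)) (y 0)) ∧
      (∀ r s, r + s ≤ K + 1 → scomm τ (u r) (v s) = scomm τ (u (r + s)) (v 0)) := by
    intro K
    induction K with
    | zero => exact ⟨base P, base P.symm⟩
    | succ K ih =>
      exact ⟨P.scomm_modes_succ (by omega) ih.1 ih.2, P.symm.scomm_modes_succ (by omega) ih.2 ih.1⟩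
  exact fun K => ⟨fun r s h => (step K).1 r s (by omega), fun r s h => (step K).2 r s (by omega)⟩

theorem anticomm_x (P : IsNodePair x y u v S T σ τ κ c) (h : x 0 * x 0 + x 0 * x 0 = 0)
    (r s : ℕ) : x r * x s + x s * x r = 0 :=
  anticomm_eq_zero (h := fun p => scomm τ (u p) (v 0)) P.c_ne_zero P.S_x P.weight_x_modes
    (fun p r => P.lie_scomm_x p 0 r) h r s

theorem anticomm_y (P : IsNodePair x y u v S T σ τ κ c) (h : y 0 * y 0 + y 0 * y 0 = 0)
    (r s : ℕ) : y r * y s + y s * y r = 0 :=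
  anticomm_eq_zero (h := fun p => scomm τ (u 0) (v p)) (κ := -κ) (S := -S)
    (neg_ne_zero.mpr P.c_ne_zero) (fun r => by rw [neg_lie, P.S_y, neg_neg])
    (fun r => by rw [P.weight_y_modes, neg_smul])
    (fun p r => by rw [P.lie_scomm_y p 0 r, neg_smul, sub_eq_add_neg]) h r s

end IsNodePair

theorem scomm_one (x y : A) : scomm 1 x y = ⁅x, y⁆ := by rw [scomm, one_smul, Ring.lie_def]

theorem sbr_zero_left (q : ℕ) (x y : A) : sbr 0 q x y = ⁅x, y⁆ := by
  simp [sbr, Ring.lie_def]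

theorem sbr_zero_right (p : ℕ) (x y : A) : sbr p 0 x y = ⁅x, y⁆ := by
  simp [sbr, Ring.lie_def]

theorem sbr_one_one (x y : A) : sbr 1 1 x y = scomm (-1) x y := by
  simp [sbr, scomm]

theorem sgn_mul_self (b : Bool) : sgn b * sgn b = 1 := by cases b <;> simp [sgn]

theorem sgn_ne_zero (b : Bool) : sgn b ≠ 0 := by cases b <;> simp [sgn]

theorem ppar_natCast {m n k : ℕ} (hk : k < m + n) :
    ppar m n (k : ZMod (m + n)) = if 1 ≤ k ∧ k ≤ m then 0 else 1 := by
  rw [ppar, ZMod.val_natCast_of_lt hk]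

/-- Around an odd node `i` the parity changes exactly once. -/
theorem ppar_odd_node {m n : ℕ} (hm : 2 ≤ m) (hn : 2 ≤ n) {i : ZMod (m + n)}
    (hi : i = 0 ∨ i = (m : ZMod (m + n))) :
    ppar m n (i + 1 + 1) = ppar m n (i + 1) ∧
      ((ppar m n i = 0 ∧ ppar m n (i + 1) = 1) ∨ (ppar m n i = 1 ∧ ppar m n (i + 1) = 0)) := by
  rcases hi with rfl | rfl
  · have h0 := ppar_natCast (m := m) (n := n) (k := 0) (by omega)
    have h1 := ppar_natCast (m := m) (n := n) (k := 1) (by omega)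
    have h2 := ppar_natCast (m := m) (n := n) (k := 2) (by omega)
    rw [if_neg (by omega)] at h0
    rw [if_pos (by omega)] at h1 h2
    push_cast at h0 h1 h2
    rw [zero_add, one_add_one_eq_two]
    exact ⟨h2.trans h1.symm, Or.inr ⟨h0, h1⟩⟩
  · have h0 := ppar_natCast (m := m) (n := n) (k := m) (by omega)
    have h1 := ppar_natCast (m := m) (n := n) (k := m + 1) (by omega)
    rw [if_pos (by omega)] at h0
    rw [if_neg (by omega)] at h1
    have h2 : ppar m n ((m + 1 + 1 : ℕ) : ZMod (m + n)) = 1 := by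
      rcases hn.eq_or_lt with rfl | hn'
      · rw [ZMod.natCast_self]
        simp [ppar]
      · rw [ppar_natCast (by omega), if_neg (by omega)]
    push_cast at h0 h1 h2
    exact ⟨h2.trans h1.symm, Or.inl ⟨h0, h1⟩⟩

theorem zmod_natCast_ne_zero {m n k : ℕ} (hk : 0 < k) (hk' : k < m + n) :
    (k : ZMod (m + n)) ≠ 0 := fun h =>
  absurd (Nat.le_of_dvd hk ((ZMod.natCast_eq_zero_iff _ _).mp h)) (by omega)

/-- The Cartan data of an odd node `i` and its successor. -/
theorem cartan_odd_node {m n : ℕ} (hm : 2 ≤ m) (hn : 2 ≤ n) {i : ZMod (m + n)}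
    (hi : i = 0 ∨ i = (m : ZMod (m + n))) :
    gpar m n i = 1 ∧ gpar m n (i + 1) = 0 ∧ i ≠ i + 1 ∧
      ¬ (i + 1 = 0 ∨ i + 1 = (m : ZMod (m + n))) ∧ aC m n i i = 0 ∧
      ∃ a : ℂ, a ≠ 0 ∧ aC m n i (i + 1) = a ∧ aC m n (i + 1) i = a ∧
        aC m n (i + 1) (i + 1) = -2 * a ∧ bC m n i (i + 1) = a ∧ bC m n (i + 1) i = a := by
  have one_ne : (1 : ZMod (m + n)) ≠ 0 := by
    exact_mod_cast zmod_natCast_ne_zero (m := m) (n := n) one_pos (by omega)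
  have two_ne : (1 + 1 : ZMod (m + n)) ≠ 0 := by
    exact_mod_cast zmod_natCast_ne_zero (m := m) (n := n) (k := 1 + 1) (by omega) (by omega)
  have d1 : i ≠ i + 1 := by simpa using one_ne
  have d2 : i ≠ i + 1 + 1 := by simpa [add_assoc] using two_ne
  have d3 : i + 1 ≠ i := d1.symm
  have d4 : i + 1 ≠ 0 := by
    rcases hi with rfl | rfl
    · simpa using one_ne
    · exact_mod_cast zmod_natCast_ne_zero (m := m) (n := n) (k := m + 1) (by omega) (by omega)
  have d5 : i + 1 ≠ (m : ZMod (m + n)) := by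
    rcases hi with rfl | rfl
    · intro h
      have h' : (((m - 1 : ℕ) : ℕ) : ZMod (m + n)) = 0 := by
        rw [Nat.cast_sub (by omega), ← h]; simp
      exact zmod_natCast_ne_zero (by omega) (by omega) h'
    · exact d3
  have d6 : ¬ (i + 1 = ((m + n - 1 : ℕ) : ZMod (m + n)) ∧ i = 0) := by
    rintro ⟨h1, h2⟩
    apply d2
    rw [h1, h2, ← Nat.cast_add_one, Nat.sub_add_cancel (by omega), ZMod.natCast_self]
  obtain ⟨h2, h01⟩ := ppar_odd_node hm hn hi
  refine ⟨?_, ?_, d1, by tauto, ?_, -(-1) ^ ppar m n (i + 1), ?_, ?_, ?_, ?_, ?_, ?_⟩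
  · rcases h01 with ⟨h0, h1⟩ | ⟨h0, h1⟩ <;> rw [gpar, h0, h1]
  · rcases h01 with ⟨h0, h1⟩ | ⟨h0, h1⟩ <;> rw [gpar, h2, h1]
  · rcases h01 with ⟨h0, h1⟩ | ⟨h0, h1⟩ <;> simp [aC, aZ, h0, h1]
  · simp
  · simp [aC, aZ, one_ne]
  · simp [aC, aZ, d2, d3]
  · rcases h01 with ⟨h0, h1⟩ | ⟨h0, h1⟩ <;> norm_num [aC, aZ, h2, h1]
  · rcases h01 with ⟨h0, h1⟩ | ⟨h0, h1⟩ <;> simp [bC, d4, d2, h0, h1]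
  · simp only [bC, if_neg d6, if_true, h2]

namespace YtildeRep

variable {m n : ℕ} {ε₁ ε₂ : ℂ} (R : YtildeRep m n ε₁ ε₂ A)
include R

/-- Since `b_{i,i+1} = b_{i+1,i}` at an odd node `i`, the representation degenerates there when
`ε₁ ≠ ε₂`. -/
theorem X_zero_eq_zero_of_ne (hm : 2 ≤ m) (hn : 2 ≤ n) (hε : (ε₁ - ε₂) / 2 ≠ 0)
    {i : ZMod (m + n)} (hi : i = 0 ∨ i = (m : ZMod (m + n))) (b : Bool) : R.X b i 0 = 0 := by
  obtain ⟨gi, gj, hij, -, -, a, ha, aij, aji, -, bij, bji⟩ := cartan_odd_node hm hn hi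
  have h1 := R.rel26 b i (i + 1)
  have h2 := R.rel26 b (i + 1) i
  simp only [gi, gj, sbr_zero_left, sbr_zero_right, aij, aji, bij, bji, acm] at h1 h2
  have same : ⁅R.X b i 0, R.X b (i + 1) 0⁆ = 0 := by
    have : (2 * (a * ((ε₁ - ε₂) / 2))) • ⁅R.X b i 0, R.X b (i + 1) 0⁆ = 0 := by
      simp only [Ring.lie_def] at h1 h2 ⊢
      linear_combination (norm := module) h1 - h2
    exact (smul_eq_zero.mp this).resolve_left (mul_ne_zero two_ne_zero (mul_ne_zero ha hε))
  have comm : ∀ b', ⁅R.X b i 0, R.X b' (i + 1) 0⁆ = 0 := by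
    intro b'
    have h3 := R.rel22 i (i + 1)
    have h4 := R.rel22 (i + 1) i
    rw [if_neg hij, gj, sbr_zero_right] at h3
    rw [if_neg hij.symm, gj, sbr_zero_left, ← lie_skew, neg_eq_zero] at h4
    match b, b' with
    | true, true => exact same
    | false, false => exact same
    | true, false => exact h3
    | false, true => exact h4
  have h5 := R.rel22 (i + 1) (i + 1)
  rw [if_pos rfl, gj, sbr_zero_left] at h5
  have h6 := R.rel24 b (i + 1) i 0 zero_le_one
  rw [← Ring.lie_def, ← h5, ← lie_skew, leibniz_lie, comm, comm, zero_lie, lie_zero, add_zero,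
    neg_zero, aji] at h6
  exact (smul_eq_zero.mp h6.symm).resolve_left (mul_ne_zero (sgn_ne_zero b) ha)

theorem X_eq_zero_of_ne (hm : 2 ≤ m) (hn : 2 ≤ n) (hε : (ε₁ - ε₂) / 2 ≠ 0)
    {i : ZMod (m + n)} (hi : i = 0 ∨ i = (m : ZMod (m + n))) (b : Bool) (r : ℕ) :
    R.X b i r = 0 := by
  have h0 := R.X_zero_eq_zero_of_ne hm hn hε hi b
  obtain ⟨-, -, -, -, -, a, ha, -, aji, -⟩ := cartan_odd_node hm hn hi
  have h1 : R.X b i 1 = 0 := by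
    have h := R.rel25 b (i + 1) i
    rw [h0, mul_zero, zero_mul, sub_zero, smul_zero, sub_zero, aji] at h
    exact (smul_eq_zero.mp h.symm).resolve_left (mul_ne_zero (sgn_ne_zero b) ha)
  match r with
  | 0 => exact h0
  | r + 1 =>
    induction r with
    | zero => exact h1
    | succ r ih => rw [R.recX b i (r + 1) (by omega), if_pos hi, ih]; simp

theorem H_eq (i : ZMod (m + n)) (r : ℕ) :
    R.H i r = sbr (gpar m n i) (gpar m n i) (R.X true i r) (R.X false i 0) := by
  match r with
  | 0 => rw [R.rel22, if_pos rfl]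
  | 1 => rw [R.rel23a, if_pos rfl]
  | r + 2 => exact R.recH i (r + 1) (by omega)

theorem lie_htld (i j : ZMod (m + n)) :
    ⁅htld m n ε₁ ε₂ R.H i, htld m n ε₁ ε₂ R.H j⁆ = 0 := by
  have c : ∀ r s, r ≤ 1 → s ≤ 1 → ⁅R.H i r, R.H j s⁆ = 0 := fun r s hr hs => by
    rw [Ring.lie_def, R.rel21 i j r s hr hs, sub_self]
  have c' : ∀ r s, r ≤ 1 → s ≤ 1 → ⁅R.H j r, R.H i s⁆ = 0 := fun r s hr hs => by
    rw [← lie_skew, c s r hs hr, neg_zero]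
  simp only [htld, lie_sub, lie_smul, lie_mul_eq, sub_lie, smul_lie]
  rw [← lie_skew (R.H i 0 * R.H i 0), ← lie_skew (R.H i 0 * R.H i 0)]
  simp [lie_mul_eq, c, c']

/-- A commuting element that shifts the lowest mode shifts all of them. -/
theorem lie_X_eq_of_shift {b : Bool} {i : ZMod (m + n)} {t t' : A} {a a' : ℂ} (ha : a ≠ 0)
    (ht : ∀ r, ⁅t, R.X b i r⁆ = (sgn b * a) • R.X b i (r + 1))
    (ht' : ⁅t', R.X b i 0⁆ = (sgn b * a') • R.X b i 1) (htt' : ⁅t', t⁆ = 0) (r : ℕ) :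
    ⁅t', R.X b i r⁆ = (sgn b * a') • R.X b i (r + 1) := by
  induction r with
  | zero => exact ht'
  | succ r ih =>
    have h : ⁅t', ⁅t, R.X b i r⁆⁆ = ⁅t', (sgn b * a) • R.X b i (r + 1)⁆ := by rw [ht r]
    rw [leibniz_lie, htt', zero_lie, zero_add, ih, lie_smul, lie_smul, ht] at h
    have h' : (sgn b * a) • (⁅t', R.X b i (r + 1)⁆ - (sgn b * a') • R.X b i (r + 1 + 1)) = 0 := by
      linear_combination (norm := module) -h
    exact sub_eq_zero.mp ((smul_eq_zero.mp h').resolve_left (mul_ne_zero (sgn_ne_zero b) ha))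

theorem lie_htld_X_zero (hε : (ε₁ - ε₂) / 2 = 0) (b : Bool) (i j : ZMod (m + n)) :
    ⁅htld m n ε₁ ε₂ R.H i, R.X b j 0⁆ = (sgn b * aC m n i j) • R.X b j 1 := by
  have h := R.rel25 b i j
  rwa [hε, mul_zero, zero_smul, sub_zero, ← Ring.lie_def] at h

theorem lie_htld_X_odd (hm : 2 ≤ m) (hn : 2 ≤ n) (hε : (ε₁ - ε₂) / 2 = 0) {i : ZMod (m + n)}
    (hi : i = 0 ∨ i = (m : ZMod (m + n))) (b : Bool) (k : ZMod (m + n)) (r : ℕ) :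
    ⁅htld m n ε₁ ε₂ R.H k, R.X b i r⁆ = (sgn b * aC m n k i) • R.X b i (r + 1) := by
  obtain ⟨-, -, -, -, -, a, ha, -, aji, -⟩ := cartan_odd_node hm hn hi
  refine R.lie_X_eq_of_shift (t := htld m n ε₁ ε₂ R.H (i + 1)) (a := aC m n (i + 1) i) (aji ▸ ha)
    (fun r => ?_) (R.lie_htld_X_zero hε b k i) (R.lie_htld k (i + 1)) r
  rcases Nat.eq_zero_or_pos r with rfl | hr
  · exact R.lie_htld_X_zero hε b (i + 1) i
  · rw [R.recX b i r hr, if_pos hi, hε, mul_zero, zero_smul, add_zero, smul_smul, aji,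
      ← Ring.lie_def, mul_mul_mul_comm, sgn_mul_self, mul_inv_cancel₀ ha, one_mul, one_smul]

theorem lie_htld_X_even (hε : (ε₁ - ε₂) / 2 = 0) {j : ZMod (m + n)}
    (hj : ¬ (j = 0 ∨ j = (m : ZMod (m + n)))) (ha : aC m n j j ≠ 0)
    (b : Bool) (k : ZMod (m + n)) (r : ℕ) :
    ⁅htld m n ε₁ ε₂ R.H k, R.X b j r⁆ = (sgn b * aC m n k j) • R.X b j (r + 1) := by
  refine R.lie_X_eq_of_shift (t := htld m n ε₁ ε₂ R.H j) (a := aC m n j j) ha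
    (fun r => ?_) (R.lie_htld_X_zero hε b k j) (R.lie_htld k j) r
  rcases Nat.eq_zero_or_pos r with rfl | hr
  · exact R.lie_htld_X_zero hε b j j
  · rw [R.recX b j r hr, if_neg hj, smul_smul, ← Ring.lie_def, mul_mul_mul_comm, sgn_mul_self,
      mul_inv_cancel₀ ha, one_mul, one_smul]

/-- For `ε₁ = ε₂`, an odd node and its successor form a node pair. -/
theorem exists_isNodePair (hm : 2 ≤ m) (hn : 2 ≤ n) (hε : (ε₁ - ε₂) / 2 = 0) {i : ZMod (m + n)}
    (hi : i = 0 ∨ i = (m : ZMod (m + n))) :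
    ∃ (S T : A) (κ c : ℂ), IsNodePair (R.X true i) (R.X false i) (R.X true (i + 1))
      (R.X false (i + 1)) S T (-1) 1 κ c := by
  have oX := R.lie_htld_X_odd hm hn hε hi
  obtain ⟨gi, gj, hij, hj, aii, a, ha, aij, aji, ajj, -, -⟩ := cartan_odd_node hm hn hi
  have eX := R.lie_htld_X_even hε hj (by rw [ajj]; exact mul_ne_zero (by norm_num) ha)
  have G0 : scomm 1 (R.X true (i + 1) 0) (R.X false (i + 1) 0) = R.H (i + 1) 0 := by
    rw [R.H_eq, gj, sbr_zero_left, scomm_one]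
  have G1 : scomm 1 (R.X true (i + 1) 1) (R.X false (i + 1) 0) = R.H (i + 1) 1 := by
    rw [R.H_eq, gj, sbr_zero_left, scomm_one]
  have g0 : scomm (-1) (R.X true i 0) (R.X false i 0) = R.H i 0 := by
    rw [R.H_eq, gi, sbr_one_one]
  have g1 : scomm (-1) (R.X true i 1) (R.X false i 0) = R.H i 1 := by
    rw [R.H_eq, gi, sbr_one_one]
  have w : ∀ b k l, ⁅R.H k 0, R.X b l 0⁆ = (sgn b * aC m n k l) • R.X b l 0 := fun b k l =>
    R.rel24 b k l 0 zero_le_one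
  have adj : ∀ b, ⁅R.X b i 1, R.X b (i + 1) 0⁆ - ⁅R.X b i 0, R.X b (i + 1) 1⁆ =
      (sgn b * a * ((ε₁ + ε₂) / 2)) •
        (R.X b i 0 * R.X b (i + 1) 0 + R.X b (i + 1) 0 * R.X b i 0) := by
    intro b
    have h := R.rel26 b i (i + 1)
    rwa [gi, gj, hε, mul_zero, zero_smul, sub_zero, sbr_zero_right, sbr_zero_right, aij, acm] at h
  refine ⟨a⁻¹ • (htld m n ε₁ ε₂ R.H (i + 1) + (2 : ℂ) • htld m n ε₁ ε₂ R.H i),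
    a⁻¹ • htld m n ε₁ ε₂ R.H i, a * ((ε₁ + ε₂) / 2), a, ?_⟩
  constructor
  · intro r
    simp [add_lie, oX, aii, aji, sgn, ha]
  · intro r
    simp [add_lie, oX, aii, aji, sgn, ha]
  · intro r
    rw [smul_lie, add_lie, smul_lie, eX, eX, ajj, aij]; module
  · intro r
    rw [smul_lie, add_lie, smul_lie, eX, eX, ajj, aij]; module
  · intro r
    simp [oX, aii]
  · intro r
    simp [oX, aii]
  · intro r
    simp [eX, aij, sgn, ha]
  · intro r
    simp [eX, aij, sgn, ha]
  · simpa [sgn] using adj true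
  · rw [adj false, ← neg_smul]; simp [sgn]
  · have h := R.rel22 i (i + 1)
    rwa [if_neg hij, gj, sbr_zero_right] at h
  · have h := R.rel22 (i + 1) i
    rwa [if_neg hij.symm, gj, sbr_zero_left] at h
  · rw [G0, w, aji]; simp [sgn]
  · rw [G0, w, aji]; simp [sgn]
  · rw [g0, w, aij]; simp [sgn]
  · rw [g0, w, aij]; simp [sgn]
  · have h := R.rel23b i i
    rw [if_pos rfl, gi, sbr_one_one] at h
    rw [g1, h]
  · have h := R.rel23b (i + 1) (i + 1)
    rw [if_pos rfl, gj, sbr_zero_left] at h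
    rw [G1, scomm_one, h]
  · rw [G1, g1, Ring.lie_def, R.rel21 (i + 1) i 1 1 le_rfl le_rfl, sub_self]
  · exact ha

end YtildeRep

theorem affine_super_yangian_stmt11
    (m n : ℕ) (hm : 2 ≤ m) (hn : 2 ≤ n) (hmn : m ≠ n) (ε₁ ε₂ : ℂ)
    (B : Type*) [Ring B] [Algebra ℂ B] (R : YtildeRep m n ε₁ ε₂ B)
    (i : ZMod (m + n)) (hi : i = 0 ∨ i = (m : ZMod (m + n))) (r s : ℕ) :
    (∀ b : Bool, sbr (gpar m n i) (gpar m n i) (R.X b i r) (R.X b i s) = 0) ∧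
    (sbr (gpar m n i) (gpar m n i) (R.X true i r) (R.X false i s) = R.H i (r + s)) := by
  by_cases hε : (ε₁ - ε₂) / 2 = 0
  · obtain ⟨S, T, κ, c, P⟩ := R.exists_isNodePair hm hn hε hi
    have gi := (cartan_odd_node hm hn hi).1
    have anti : ∀ x y : B, sbr (gpar m n i) (gpar m n i) x y = x * y + y * x := fun x y => by
      rw [gi, sbr_one_one, scomm, neg_smul, one_smul, sub_neg_eq_add]
    refine ⟨fun b => ?_, ?_⟩
    · have h := R.rel28 b i hi
      rw [anti] at h ⊢
      cases b
      · exact P.anticomm_y h r s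
      · exact P.anticomm_x h r s
    · rw [R.H_eq, gi, sbr_one_one, sbr_one_one]
      exact (P.scomm_modes (r + s)).1 r s le_rfl
  · have h := R.X_eq_zero_of_ne hm hn hε hi
    refine ⟨fun b => ?_, ?_⟩
    · simp [sbr, h]
    · rw [R.H_eq]; simp [sbr, h]

end
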